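/- Define F(p,s) = ∫_0^∞ |𝔧₁(t)|^s t^{p-1} dt and G(p,s) = s^{-p/2} 2^{3p/2-1} Γ(p/2). Then for every p with 4/5 ≤ p ≤ 2, F(p, 8/3) < e^{-p/6} G(p, 2). -/

import Mathlib

open MeasureTheory Real Set
open scoped ENNReal

/-- `𝔧₁(t) = ∑_{k=0}^∞ (-1)^k / (k! (k+1)!) (t/2)^{2k} = 2J₁(t)/t`. -/
noncomputable def jj1 (t : ℝ) : ℝ :=
  ∑' k : ℕ, ((-1 : ℝ) ^ k / ((k.factorial : ℝ) * ((k + 1).factorial : ℝ))) * (t / 2) ^ (2 * k)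

/-- `G(p,s) = s^{-p/2} 2^{3p/2-1} Γ(p/2)`. -/
noncomputable def Gfun (p s : ℝ) : ℝ :=
  s ^ (-p / 2) * 2 ^ (3 * p / 2 - 1) * Real.Gamma (p / 2)

/-! ### The Bessel–Clifford functions -/

/-- The Bessel–Clifford function `∑ (-z)^k / (k! (k+n)!)`, equal to `z^{-n/2} J_n(2 √z)`. -/
noncomputable def cliff (n : ℕ) (z : ℝ) : ℝ :=
  ∑' k : ℕ, (-z) ^ k / ((k.factorial : ℝ) * ((k + n).factorial : ℝ))

lemma summable_cliff (n : ℕ) (z : ℝ) :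
    Summable fun k : ℕ => (-z) ^ k / ((k.factorial : ℝ) * ((k + n).factorial : ℝ)) := by
  refine Summable.of_norm_bounded (Real.summable_pow_div_factorial |z|) fun k => ?_
  rw [Real.norm_eq_abs, abs_div, abs_pow, abs_neg, abs_of_pos (a := (k.factorial : ℝ) * _)
    (by positivity)]
  refine div_le_div_of_nonneg_left (by positivity) (by positivity) ?_
  have : (1 : ℝ) ≤ ((k + n).factorial : ℝ) := by
    exact_mod_cast Nat.one_le_iff_ne_zero.2 (Nat.factorial_ne_zero _)
  nlinarith [show (0 : ℝ) < k.factorial by positivity]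

lemma jj1_eq_cliff (t : ℝ) : jj1 t = cliff 1 (t ^ 2 / 4) := by
  refine tsum_congr fun k => ?_
  rw [show -(t ^ 2 / 4) = (-1) * (t / 2) ^ 2 by ring, mul_pow, ← pow_mul]
  ring

lemma hasDerivAt_cliff (n : ℕ) (z : ℝ) : HasDerivAt (cliff n) (-cliff (n + 1) z) z := by
  set R : ℝ := |z| + 1
  have hR : 0 ≤ R := by positivity
  have key := hasDerivAt_tsum_of_isPreconnected (𝕜 := ℝ) (F := ℝ)
    (u := fun k : ℕ => k * R ^ (k - 1) / k.factorial)
    (g := fun (k : ℕ) (z : ℝ) => (-z) ^ k / ((k.factorial : ℝ) * ((k + n).factorial : ℝ)))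
    (g' := fun (k : ℕ) (z : ℝ) =>
      (k * (-z) ^ (k - 1) * (-1)) / ((k.factorial : ℝ) * ((k + n).factorial : ℝ)))
    (t := Metric.ball 0 R) (y₀ := 0) (y := z) ?_ Metric.isOpen_ball
    (convex_ball 0 R).isPreconnected ?_ ?_ (by simp [R]; positivity) (summable_cliff n 0)
    (by simp [R])
  · refine key.congr_deriv ?_
    rw [← (summable_nat_add_iff 1).1 ?_ |>.sum_add_tsum_nat_add 1]
    · simp only [Finset.range_one, Finset.sum_singleton, Nat.cast_zero, zero_mul, zero_div,
        zero_add]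
      rw [cliff, ← tsum_neg]
      refine tsum_congr fun k => ?_
      rw [Nat.factorial_succ, show k + 1 + n = k + (n + 1) by ring]
      push_cast
      have : (k.factorial : ℝ) ≠ 0 := by positivity
      have : ((k + (n + 1)).factorial : ℝ) ≠ 0 := by positivity
      field_simp
    · convert (summable_cliff (n + 1) z).neg using 1
      ext k
      rw [Nat.factorial_succ, show k + 1 + n = k + (n + 1) by ring]
      push_cast
      have : (k.factorial : ℝ) ≠ 0 := by positivity
      have : ((k + (n + 1)).factorial : ℝ) ≠ 0 := by positivity
      field_simp
  · rw [← summable_nat_add_iff 1]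
    refine (Real.summable_pow_div_factorial R).congr fun k => ?_
    rw [Nat.factorial_succ]
    push_cast
    have : (k.factorial : ℝ) ≠ 0 := by positivity
    field_simp
  · intro k y _
    have := (((hasDerivAt_id y).neg.pow k).div_const
      ((k.factorial : ℝ) * ((k + n).factorial : ℝ)))
    exact this
  · intro k y hy
    have hy' : |y| ≤ R := by
      have := mem_ball_zero_iff.1 hy
      rw [Real.norm_eq_abs] at this
      exact this.le
    rw [Real.norm_eq_abs, abs_div, abs_of_pos (a := (k.factorial : ℝ) * _) (by positivity),
      abs_mul, abs_mul, abs_pow, abs_neg, abs_neg, abs_one, mul_one, Nat.abs_cast]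
    have h1 : (1 : ℝ) ≤ ((k + n).factorial : ℝ) := by
      exact_mod_cast Nat.one_le_iff_ne_zero.2 (Nat.factorial_ne_zero _)
    have h2 : (k.factorial : ℝ) ≤ k.factorial * ((k + n).factorial : ℝ) := by
      nlinarith [show (0 : ℝ) < k.factorial by positivity]
    gcongr

lemma continuous_cliff (n : ℕ) : Continuous (cliff n) :=
  continuous_iff_continuousAt.2 fun z => (hasDerivAt_cliff n z).continuousAt

lemma cliff_recurrence (n : ℕ) (z : ℝ) :
    cliff n z = (n + 1) * cliff (n + 1) z - z * cliff (n + 2) z := by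
  have h0 := (summable_cliff (n + 1) z).mul_left ((n : ℝ) + 1)
  have h1 := summable_cliff n z
  have h2 := (summable_cliff (n + 2) z).mul_left z
  rw [eq_sub_iff_add_eq, cliff, cliff, cliff, ← tsum_mul_left, ← tsum_mul_left,
    ← h0.sum_add_tsum_nat_add 1, ← h1.sum_add_tsum_nat_add 1, add_assoc,
    ← ((summable_nat_add_iff 1).2 h1).tsum_add h2]
  congr 1
  · have : (n.factorial : ℝ) ≠ 0 := by positivity
    simp [Nat.factorial_succ]
    field_simp
  · refine tsum_congr fun k => ?_
    rw [show k + 1 + n = k + n + 1 by ring, show k + (n + 2) = k + n + 1 + 1 by ring,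
      show k + 1 + (n + 1) = k + n + 1 + 1 by ring, Nat.factorial_succ (k + n + 1),
      Nat.factorial_succ k]
    have : (k.factorial : ℝ) ≠ 0 := by positivity
    have : ((k + n + 1).factorial : ℝ) ≠ 0 := by positivity
    push_cast
    field_simp
    ring

lemma cliff_zero_right (n : ℕ) : cliff n 0 = 1 / n.factorial := by
  rw [cliff, tsum_eq_single 0]
  · simp
  · intro k hk
    simp [hk]

/-- Truncation error of the series, valid once its terms decrease by a factor of at least `2`. -/
lemma abs_cliff_sub_le (n N : ℕ) {z : ℝ} (hz : 0 ≤ z) (hN : 2 * z ≤ (N + 1) * (N + 1 + n)) :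
    |cliff n z - ∑ k ∈ Finset.range N, (-z) ^ k / ((k.factorial : ℝ) * ((k + n).factorial : ℝ))|
      ≤ 2 * (z ^ N / ((N.factorial : ℝ) * ((N + n).factorial : ℝ))) := by
  rw [cliff, ← (summable_cliff n z).sum_add_tsum_nat_add N, add_sub_cancel_left]
  have hg := hasSum_geometric_two.mul_right
    (z ^ N / ((N.factorial : ℝ) * ((N + n).factorial : ℝ)))
  rw [← Real.norm_eq_abs]
  refine tsum_of_norm_bounded hg fun k => ?_
  rw [Real.norm_eq_abs, abs_div, abs_pow, abs_neg, abs_of_nonneg hz,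
    abs_of_pos (a := ((k + N).factorial : ℝ) * _) (by positivity)]
  induction k with
  | zero => simp
  | succ k ih =>
    rw [pow_succ (1 / 2 : ℝ), mul_right_comm]
    refine le_trans (le_of_eq ?_) (mul_le_mul ih
      (show z / ((k + N + 1) * (k + N + n + 1)) ≤ 1 / 2 from ?_) (by positivity) (by positivity))
    · rw [show k + 1 + N = k + N + 1 by ring, show k + N + 1 + n = k + N + n + 1 by ring,
        Nat.factorial_succ (k + N), Nat.factorial_succ (k + N + n)]
      have : ((k + N).factorial : ℝ) ≠ 0 := by positivity
      have : ((k + N + n).factorial : ℝ) ≠ 0 := by positivity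
      push_cast
      field_simp
      try ring
    · rw [div_le_iff₀ (by positivity)]
      have hk : (0 : ℝ) ≤ k := by positivity
      have hN0 : (0 : ℝ) ≤ N := by positivity
      have hn : (0 : ℝ) ≤ n := by positivity
      nlinarith [mul_nonneg hk hk, mul_nonneg hk hN0, mul_nonneg hk hn]

lemma cliff_mem_Icc (n N : ℕ) {z lo hi : ℝ} (hz : 0 ≤ z)
    (hN : 2 * z ≤ (N + 1) * (N + 1 + n))
    (hlo : lo + 2 * (z ^ N / ((N.factorial : ℝ) * ((N + n).factorial : ℝ))) ≤
      ∑ k ∈ Finset.range N, (-z) ^ k / ((k.factorial : ℝ) * ((k + n).factorial : ℝ)))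
    (hhi : ∑ k ∈ Finset.range N, (-z) ^ k / ((k.factorial : ℝ) * ((k + n).factorial : ℝ)) +
      2 * (z ^ N / ((N.factorial : ℝ) * ((N + n).factorial : ℝ))) ≤ hi) :
    cliff n z ∈ Icc lo hi := by
  have := abs_le.1 (abs_cliff_sub_le n N hz hN)
  constructor <;> linarith [this.1, this.2]

/-! ### Monotone quantities -/

/-- `J₀² + J₁²` at `2 √z`. -/
noncomputable def besselPhi (z : ℝ) : ℝ := cliff 0 z ^ 2 + z * cliff 1 z ^ 2

/-- `y² + y'²` for `y = 2 J₁(t) / t`, at `t = 2 √z`. -/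
noncomputable def besselEnergy (z : ℝ) : ℝ := cliff 1 z ^ 2 + z * cliff 2 z ^ 2

lemma hasDerivAt_besselPhi (z : ℝ) : HasDerivAt besselPhi (-cliff 1 z ^ 2) z := by
  have h := ((hasDerivAt_cliff 0 z).pow 2).add
    ((hasDerivAt_id z).mul ((hasDerivAt_cliff 1 z).pow 2))
  refine h.congr_deriv ?_
  have h0 := cliff_recurrence 0 z
  norm_num at h0 ⊢
  rw [h0]
  ring

lemma hasDerivAt_besselEnergy (z : ℝ) : HasDerivAt besselEnergy (-3 * cliff 2 z ^ 2) z := by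
  have h := ((hasDerivAt_cliff 1 z).pow 2).add
    ((hasDerivAt_id z).mul ((hasDerivAt_cliff 2 z).pow 2))
  refine h.congr_deriv ?_
  have h1 := cliff_recurrence 1 z
  norm_num at h1 ⊢
  rw [h1]
  ring

lemma antitone_besselEnergy : Antitone besselEnergy := by
  refine antitone_of_deriv_nonpos (fun z => (hasDerivAt_besselEnergy z).differentiableAt)
    fun z => ?_
  rw [(hasDerivAt_besselEnergy z).deriv]
  nlinarith [sq_nonneg (cliff 2 z)]

lemma antitone_besselPhi : Antitone besselPhi := by
  refine antitone_of_deriv_nonpos (fun z => (hasDerivAt_besselPhi z).differentiableAt)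
    fun z => ?_
  rw [(hasDerivAt_besselPhi z).deriv]
  nlinarith [sq_nonneg (cliff 1 z)]

lemma besselPhi_nonneg {z : ℝ} (hz : 0 ≤ z) : 0 ≤ besselPhi z := by
  unfold besselPhi
  positivity

lemma cliff_one_sq_le {y z : ℝ} (hy : 0 ≤ y) (hyz : y ≤ z) : cliff 1 z ^ 2 ≤ besselEnergy y := by
  refine le_trans ?_ (antitone_besselEnergy hyz)
  have : 0 ≤ z := hy.trans hyz
  rw [besselEnergy]
  nlinarith [mul_nonneg this (sq_nonneg (cliff 2 z))]

lemma abs_cliff_one_le_one {z : ℝ} (hz : 0 ≤ z) : |cliff 1 z| ≤ 1 := by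
  have h := cliff_one_sq_le le_rfl hz
  rw [besselEnergy, cliff_zero_right] at h
  norm_num at h
  exact h

/-- A Turán-type inequality. -/
lemma cliff_turan {z : ℝ} (hz : 0 < z) : 0 ≤ cliff 2 z ^ 2 - cliff 1 z * cliff 3 z := by
  set F : ℝ → ℝ := fun z => z ^ 3 * (cliff 2 z ^ 2 - cliff 1 z * cliff 3 z)
  have hF : ∀ z, HasDerivAt F (z ^ 2 * cliff 2 z ^ 2) z := fun z => by
    have h := ((hasDerivAt_id z).pow 3).mul (((hasDerivAt_cliff 2 z).pow 2).sub
      ((hasDerivAt_cliff 1 z).mul (hasDerivAt_cliff 3 z)))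
    refine h.congr_deriv ?_
    have h1 := cliff_recurrence 1 z
    have h2 := cliff_recurrence 2 z
    norm_num at h1 h2 ⊢
    rw [h1, h2]
    ring
  have hmono : Monotone F := monotone_of_deriv_nonneg
    (fun z => (hF z).differentiableAt) fun z => by rw [(hF z).deriv]; positivity
  have h := hmono hz.le
  simp only [F] at h
  have h3 : (0 : ℝ) < z ^ 3 := by positivity
  exact nonneg_of_mul_nonneg_right (by simpa using h) h3

/-! ### Positivity and log-concavity before the first zero -/

lemma cliff_pos_of_succ {n : ℕ} {Z : ℝ} (h : ∀ z ∈ Icc 0 Z, 0 < cliff (n + 1) z)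
    (hZ : 0 < cliff n Z) : ∀ z ∈ Icc 0 Z, 0 < cliff n z := by
  intro z hz
  have hanti : AntitoneOn (cliff n) (Icc 0 Z) := by
    refine antitoneOn_of_deriv_nonpos (convex_Icc 0 Z) (continuous_cliff n).continuousOn
      (fun x _ => (hasDerivAt_cliff n x).differentiableAt.differentiableWithinAt) fun x hx => ?_
    rw [(hasDerivAt_cliff n x).deriv]
    exact neg_nonpos.2 (h x (interior_subset hx)).le
  exact hZ.trans_le (hanti hz ⟨hz.1.trans hz.2, le_rfl⟩ hz.2)

lemma cliff_pos_of_large {n : ℕ} {z : ℝ} (hz : 0 ≤ z) (hn : 2 * z < n + 1) : 0 < cliff n z := by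
  have h := abs_cliff_sub_le n 1 hz (by push_cast; nlinarith)
  have h1 := (abs_le.1 h).1
  rw [Finset.sum_range_one, add_comm 1 n, Nat.factorial_succ n] at h1
  simp only [pow_zero, pow_one, Nat.factorial_zero, Nat.factorial_one, zero_add, Nat.cast_one,
    one_mul, Nat.cast_mul, Nat.cast_add] at h1
  have hf : (0 : ℝ) < n.factorial := by positivity
  have : 2 * (z / (((n : ℝ) + 1) * n.factorial)) < 1 / n.factorial := by
    rw [mul_div_assoc', div_lt_div_iff₀ (by positivity) hf]
    nlinarith
  linarith

lemma cliff_pos {n : ℕ} (hn : 1 ≤ n) : ∀ z ∈ Icc (0 : ℝ) (1369 / 400), 0 < cliff n z := by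
  have h7 : ∀ m, 7 ≤ m → ∀ z ∈ Icc (0 : ℝ) (1369 / 400), 0 < cliff m z := fun m hm z hz => by
    have : (7 : ℝ) ≤ m := by exact_mod_cast hm
    exact cliff_pos_of_large hz.1 (by linarith [hz.2])
  have step : ∀ (m : ℕ) (lo : ℝ), 0 < lo → cliff m (1369 / 400) ∈ Icc lo 1 →
      (∀ z ∈ Icc (0 : ℝ) (1369 / 400), 0 < cliff (m + 1) z) →
      ∀ z ∈ Icc (0 : ℝ) (1369 / 400), 0 < cliff m z := fun m lo hlo hm h =>
    cliff_pos_of_succ h (hlo.trans_le hm.1)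
  have h6 := step 6 (1 / 1200) (by norm_num) (by
    apply cliff_mem_Icc 6 10 <;> norm_num [Finset.sum_range_succ, Nat.factorial]) (h7 7 le_rfl)
  have h5 := step 5 (1 / 300) (by norm_num) (by
    apply cliff_mem_Icc 5 10 <;> norm_num [Finset.sum_range_succ, Nat.factorial]) h6
  have h4 := step 4 (1 / 60) (by norm_num) (by
    apply cliff_mem_Icc 4 10 <;> norm_num [Finset.sum_range_succ, Nat.factorial]) h5
  have h3 := step 3 (1 / 20) (by norm_num) (by
    apply cliff_mem_Icc 3 10 <;> norm_num [Finset.sum_range_succ, Nat.factorial]) h4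
  have h2 := step 2 (1 / 20) (by norm_num) (by
    apply cliff_mem_Icc 2 10 <;> norm_num [Finset.sum_range_succ, Nat.factorial]) h3
  have h1 := step 1 (1 / 50) (by norm_num) (by
    apply cliff_mem_Icc 1 10 <;> norm_num [Finset.sum_range_succ, Nat.factorial]) h2
  rcases le_or_gt 7 n with h | h
  · exact h7 n h
  · interval_cases n <;> assumption

lemma concaveOn_log_cliff : ConcaveOn ℝ (Icc 0 (1369 / 400)) fun z => log (cliff 1 z) := by
  have hd : ∀ z ∈ Icc (0 : ℝ) (1369 / 400),
      HasDerivAt (fun z => log (cliff 1 z)) (-cliff 2 z / cliff 1 z) z := fun z hz =>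
    (hasDerivAt_cliff 1 z).log (cliff_pos le_rfl z hz).ne'
  have hd2 : ∀ z ∈ Icc (0 : ℝ) (1369 / 400),
      HasDerivAt (fun z => -cliff 2 z / cliff 1 z)
        (-(cliff 2 z ^ 2 - cliff 1 z * cliff 3 z) / cliff 1 z ^ 2) z := fun z hz => by
    refine ((hasDerivAt_cliff 2 z).neg.div (hasDerivAt_cliff 1 z)
      (cliff_pos le_rfl z hz).ne').congr_deriv ?_
    norm_num
    ring
  refine AntitoneOn.concaveOn_of_deriv (convex_Icc _ _)
    (fun z hz => (hd z hz).continuousAt.continuousWithinAt)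
    (fun z hz => (hd z (interior_subset hz)).differentiableAt.differentiableWithinAt) ?_
  have hanti : AntitoneOn (fun z => -cliff 2 z / cliff 1 z) (Icc 0 (1369 / 400)) := by
    refine antitoneOn_of_deriv_nonpos (convex_Icc _ _)
      (fun z hz => (hd2 z hz).continuousAt.continuousWithinAt)
      (fun z hz => (hd2 z (interior_subset hz)).differentiableAt.differentiableWithinAt)
      fun z hz => ?_
    rw [(hd2 z (interior_subset hz)).deriv]
    rw [interior_Icc] at hz
    exact div_nonpos_of_nonpos_of_nonneg (neg_nonpos.2 (cliff_turan hz.1)) (sq_nonneg _)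
  intro x hx y hy hxy
  rw [(hd x (interior_subset hx)).deriv, (hd y (interior_subset hy)).deriv]
  exact hanti (interior_subset hx) (interior_subset hy) hxy

lemma cliff_one_le_exp_tangent {m z : ℝ} (hm : m ∈ Icc (0 : ℝ) (1369 / 400))
    (hz : z ∈ Icc (0 : ℝ) (1369 / 400)) :
    cliff 1 z ≤ cliff 1 m * exp (-(cliff 2 m / cliff 1 m) * (z - m)) := by
  have hpm := cliff_pos le_rfl m hm
  have hpz := cliff_pos le_rfl z hz
  have hd : HasDerivAt (fun z => log (cliff 1 z)) (-cliff 2 m / cliff 1 m) m :=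
    (hasDerivAt_cliff 1 m).log hpm.ne'
  have key : log (cliff 1 z) ≤ log (cliff 1 m) + -cliff 2 m / cliff 1 m * (z - m) := by
    rcases lt_trichotomy z m with h | h | h
    · have := concaveOn_log_cliff.le_slope_of_hasDerivAt hz hm h hd
      rw [slope_def_field, le_div_iff₀ (sub_pos.2 h)] at this
      linarith
    · simp [h]
    · have := concaveOn_log_cliff.slope_le_of_hasDerivAt hm hz h hd
      rw [slope_def_field, div_le_iff₀ (sub_pos.2 h)] at this
      linarith
  rw [← log_le_log_iff hpz (by positivity), log_mul hpm.ne' (exp_pos _).ne', log_exp]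
  convert key using 2
  ring

lemma cliff_one_le_exp_of_le {c l z : ℝ} (hc : 0 < c) (hcz : c ≤ z) (hz : z ≤ 1369 / 400)
    (h : cliff 1 c ≤ exp (-l * c)) : cliff 1 z ≤ exp (-l * z) := by
  have hz0 : 0 < z := hc.trans_le hcz
  have hpc := cliff_pos le_rfl c ⟨hc.le, hcz.trans hz⟩
  have hpz := cliff_pos le_rfl z ⟨hz0.le, hz⟩
  have h0 : log (cliff 1 0) = 0 := by rw [cliff_zero_right]; simp
  have hlog : log (cliff 1 c) ≤ -l * c := (log_le_iff_le_exp hpc).2 h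
  have hconc := concaveOn_log_cliff.2
    (show (0 : ℝ) ∈ Icc 0 (1369 / 400) from ⟨le_rfl, by norm_num⟩)
    (show z ∈ Icc 0 (1369 / 400) from ⟨hz0.le, hz⟩)
    (show (0 : ℝ) ≤ 1 - c / z from sub_nonneg.2 ((div_le_one hz0).2 hcz))
    (show (0 : ℝ) ≤ c / z by positivity) (by ring)
  simp only [smul_eq_mul, h0, mul_zero, zero_add, div_mul_cancel₀ c hz0.ne'] at hconc
  rw [← log_le_iff_le_exp hpz]
  rw [div_mul_eq_mul_div, div_le_iff₀ hz0] at hconc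
  have : c * log (cliff 1 z) ≤ c * (-l * z) := by nlinarith
  exact le_of_mul_le_mul_left this hc

lemma cliff_one_le_exp_quadratic {z : ℝ} (hz : z ∈ Icc (0 : ℝ) (1369 / 400)) :
    cliff 1 z ≤ exp (-(z / 2 + z ^ 2 / 24)) := by
  set F : ℝ → ℝ := fun z => log (cliff 1 z) + (z / 2 + z ^ 2 / 24)
  have hd : ∀ z ∈ Icc (0 : ℝ) (1369 / 400),
      HasDerivAt F (-cliff 2 z / cliff 1 z + (1 / 2 + z / 12)) z := fun z hz => by
    refine (((hasDerivAt_cliff 1 z).log (cliff_pos le_rfl z hz).ne').add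
      (((hasDerivAt_id z).div_const 2).add (((hasDerivAt_id z).pow 2).div_const 24))).congr_deriv
      ?_
    norm_num
    ring
  have hanti : AntitoneOn F (Icc 0 (1369 / 400)) := by
    refine antitoneOn_of_deriv_nonpos (convex_Icc _ _)
      (fun z hz => (hd z hz).continuousAt.continuousWithinAt)
      (fun z hz => (hd z (interior_subset hz)).differentiableAt.differentiableWithinAt)
      fun z hz => ?_
    have hz' := interior_subset hz
    rw [(hd z hz').deriv]
    have h1 := cliff_pos le_rfl z hz'
    have h3 := cliff_pos (n := 3) (by norm_num) z hz'
    have h4 := cliff_pos (n := 4) (by norm_num) z hz'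
    have r1 := cliff_recurrence 1 z
    have r2 := cliff_recurrence 2 z
    norm_num at r1 r2
    have hkey : (1 / 2 + z / 12) * cliff 1 z ≤ cliff 2 z := by
      have hz0 := hz'.1
      have : cliff 1 z ≤ 6 * cliff 3 z := by
        nlinarith [mul_nonneg hz0 h3.le, mul_nonneg hz0 h4.le]
      nlinarith
    have : 1 / 2 + z / 12 ≤ cliff 2 z / cliff 1 z := (le_div_iff₀ h1).2 hkey
    rw [neg_div]
    linarith
  have h := hanti ⟨le_rfl, by norm_num⟩ hz hz.1
  have h0 : log (cliff 1 0) = 0 := by rw [cliff_zero_right]; simp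
  simp only [F, h0] at h
  rw [← log_le_iff_le_exp (cliff_pos le_rfl z hz)]
  norm_num at h
  linarith

/-! ### Integrals of `|𝔧₁|^{8/3}` with weight `t` -/

lemma abs_rpow_le_mul_sq {y K : ℝ} (hK : 0 ≤ K) (h : y ^ 2 ≤ K ^ 3) :
    |y| ^ (8 / 3 : ℝ) ≤ K * y ^ 2 := by
  have h1 : |y| ^ (8 / 3 : ℝ) = (y ^ 2) ^ (1 / 3 : ℝ) * y ^ 2 := by
    rw [← sq_abs y, ← rpow_natCast |y| 2, ← rpow_mul (abs_nonneg y),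
      ← rpow_add_of_nonneg (abs_nonneg y) (by norm_num) (by norm_num)]
    norm_num
  have h2 : (y ^ 2) ^ (1 / 3 : ℝ) ≤ K := by
    calc (y ^ 2) ^ (1 / 3 : ℝ) ≤ (K ^ 3) ^ (1 / 3 : ℝ) := by gcongr
      _ = K := by
        rw [← rpow_natCast K 3, ← rpow_mul hK]
        norm_num
  rw [h1]
  gcongr

lemma exists_tendsto_besselPhi : ∃ l, 0 ≤ l ∧ Filter.Tendsto besselPhi Filter.atTop (nhds l) := by
  rcases tendsto_atTop_of_antitone antitone_besselPhi with h | ⟨l, hl⟩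
  · obtain ⟨z, hz, hz'⟩ := ((h.eventually_lt_atBot 0).and (Filter.eventually_ge_atTop 0)).exists
    exact absurd (besselPhi_nonneg hz') (not_le.2 hz)
  · exact ⟨l, ge_of_tendsto hl ((Filter.eventually_ge_atTop 0).mono fun z => besselPhi_nonneg), hl⟩

lemma hasDerivAt_besselPhi_sq (t : ℝ) :
    HasDerivAt (fun t => 2 * besselPhi (t ^ 2 / 4)) (-(cliff 1 (t ^ 2 / 4) ^ 2 * t)) t := by
  have h := ((hasDerivAt_besselPhi (t ^ 2 / 4)).comp t
    (((hasDerivAt_id t).pow 2).div_const 4)).const_mul 2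
  refine h.congr_deriv ?_
  norm_num
  ring

lemma tendsto_sq_div_four : Filter.Tendsto (fun t : ℝ => t ^ 2 / 4) Filter.atTop Filter.atTop :=
  (Filter.tendsto_pow_atTop two_ne_zero).atTop_div_const (by norm_num)

lemma integrableOn_cliff_sq {s : ℝ} (hs : 0 ≤ s) :
    IntegrableOn (fun t => cliff 1 (t ^ 2 / 4) ^ 2 * t) (Ioi s) := by
  obtain ⟨l, -, hl⟩ := exists_tendsto_besselPhi
  have h := integrableOn_Ioi_deriv_of_nonpos' (a := s) (fun t _ => hasDerivAt_besselPhi_sq t)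
    (fun t ht => neg_nonpos.2 (mul_nonneg (sq_nonneg _) (hs.trans (le_of_lt ht))))
    ((hl.comp tendsto_sq_div_four).const_mul 2)
  simpa using h.neg

lemma integral_cliff_sq_le {s : ℝ} (hs : 0 ≤ s) :
    ∫ t in Ioi s, cliff 1 (t ^ 2 / 4) ^ 2 * t ≤ 2 * besselPhi (s ^ 2 / 4) := by
  obtain ⟨l, hl0, hl⟩ := exists_tendsto_besselPhi
  have h := integral_Ioi_of_hasDerivAt_of_nonpos' (a := s) (fun t _ => hasDerivAt_besselPhi_sq t)
    (fun t ht => neg_nonpos.2 (mul_nonneg (sq_nonneg _) (hs.trans (le_of_lt ht))))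
    ((hl.comp tendsto_sq_div_four).const_mul 2)
  rw [integral_neg] at h
  linarith

lemma continuous_cliff_sq (n : ℕ) : Continuous fun t : ℝ => cliff n (t ^ 2 / 4) :=
  (continuous_cliff n).comp (by fun_prop)

lemma continuous_abs_cliff_rpow :
    Continuous fun t : ℝ => |cliff 1 (t ^ 2 / 4)| ^ (8 / 3 : ℝ) :=
  (continuous_cliff_sq 1).abs.rpow_const fun _ => Or.inr (by norm_num)

lemma continuous_abs_cliff_rpow_mul :
    Continuous fun t : ℝ => |cliff 1 (t ^ 2 / 4)| ^ (8 / 3 : ℝ) * t :=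
  continuous_abs_cliff_rpow.mul continuous_id

lemma integrableOn_abs_cliff_rpow {s : ℝ} (hs : 0 ≤ s) :
    IntegrableOn (fun t => |cliff 1 (t ^ 2 / 4)| ^ (8 / 3 : ℝ) * t) (Ioi s) := by
  refine Integrable.mono' (integrableOn_cliff_sq hs)
    continuous_abs_cliff_rpow_mul.aestronglyMeasurable
    ((ae_restrict_iff' measurableSet_Ioi).2 (ae_of_all _ fun t ht => ?_))
  have ht0 : 0 ≤ t := hs.trans (le_of_lt ht)
  have h1 := abs_cliff_one_le_one (z := t ^ 2 / 4) (by positivity)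
  have h2 := abs_rpow_le_mul_sq (y := cliff 1 (t ^ 2 / 4)) (K := 1) zero_le_one (by
    rw [← sq_abs]; nlinarith [abs_nonneg (cliff 1 (t ^ 2 / 4))])
  rw [one_mul] at h2
  rw [Real.norm_eq_abs, abs_of_nonneg (by positivity)]
  gcongr

/-- `∫_s^∞ |𝔧₁(t)|^{8/3} t dt`. -/
noncomputable def besselTail (s : ℝ) : ℝ :=
  ∫ t in Ioi s, |cliff 1 (t ^ 2 / 4)| ^ (8 / 3 : ℝ) * t

lemma besselTail_eq_add {s s' : ℝ} (hs : 0 ≤ s) (hss : s ≤ s') :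
    besselTail s = (∫ t in s..s', |cliff 1 (t ^ 2 / 4)| ^ (8 / 3 : ℝ) * t) + besselTail s' :=
  (intervalIntegral.integral_interval_add_Ioi (integrableOn_abs_cliff_rpow hs)
    (integrableOn_abs_cliff_rpow (hs.trans hss))).symm

lemma abs_cliff_rpow_mul_le {s t K : ℝ} (hs : 0 ≤ s) (hK : 0 ≤ K)
    (hE : besselEnergy (s ^ 2 / 4) ≤ K ^ 3) (hst : s ≤ t) :
    |cliff 1 (t ^ 2 / 4)| ^ (8 / 3 : ℝ) * t ≤ K * (cliff 1 (t ^ 2 / 4) ^ 2 * t) := by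
  have ht0 : 0 ≤ t := hs.trans hst
  rw [← mul_assoc]
  refine mul_le_mul_of_nonneg_right (abs_rpow_le_mul_sq hK ?_) ht0
  exact (cliff_one_sq_le (by positivity) (by gcongr)).trans hE

lemma besselTail_le {s K : ℝ} (hs : 0 ≤ s) (hK : 0 ≤ K) (hE : besselEnergy (s ^ 2 / 4) ≤ K ^ 3) :
    besselTail s ≤ K * (2 * besselPhi (s ^ 2 / 4)) := by
  refine le_trans (setIntegral_mono_on (integrableOn_abs_cliff_rpow hs)
    ((integrableOn_cliff_sq hs).const_mul K) measurableSet_Ioi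
    fun t ht => abs_cliff_rpow_mul_le hs hK hE (le_of_lt ht)) ?_
  rw [integral_const_mul]
  exact mul_le_mul_of_nonneg_left (integral_cliff_sq_le hs) hK

lemma besselTail_le_add {s s' K : ℝ} (hs : 0 ≤ s) (hss : s ≤ s') (hK : 0 ≤ K)
    (hE : besselEnergy (s ^ 2 / 4) ≤ K ^ 3) :
    besselTail s ≤ K * (2 * (besselPhi (s ^ 2 / 4) - besselPhi (s' ^ 2 / 4))) + besselTail s' := by
  rw [besselTail_eq_add hs hss]
  have hc : Continuous fun t : ℝ => cliff 1 (t ^ 2 / 4) ^ 2 * t :=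
    ((continuous_cliff_sq 1).pow 2).mul continuous_id
  have h1 : ∫ t in s..s', |cliff 1 (t ^ 2 / 4)| ^ (8 / 3 : ℝ) * t ≤
      ∫ t in s..s', K * (cliff 1 (t ^ 2 / 4) ^ 2 * t) :=
    intervalIntegral.integral_mono_on hss (continuous_abs_cliff_rpow_mul.intervalIntegrable _ _)
      ((hc.const_mul K).intervalIntegrable _ _)
      fun t ht => abs_cliff_rpow_mul_le hs hK hE ht.1
  have h2 := intervalIntegral.integral_eq_sub_of_hasDerivAt
    (fun t _ => hasDerivAt_besselPhi_sq t) (hc.neg.intervalIntegrable s s')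
  rw [intervalIntegral.integral_neg] at h2
  rw [intervalIntegral.integral_const_mul] at h1
  have h3 : ∫ t in s..s', cliff 1 (t ^ 2 / 4) ^ 2 * t =
      2 * (besselPhi (s ^ 2 / 4) - besselPhi (s' ^ 2 / 4)) := by linarith
  rw [h3] at h1
  linarith

lemma exp_neg_le_quartic {y : ℝ} (hy : |y| ≤ 1) :
    exp (-y) ≤ 1 - y + y ^ 2 / 2 - y ^ 3 / 6 + 5 / 96 * y ^ 4 := by
  have h := (abs_le.1 (exp_bound (x := -y) (by rwa [abs_neg]) (n := 4) (by norm_num))).2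
  rw [abs_neg, show |y| ^ 4 = y ^ 4 from (even_two_mul 2).pow_abs y] at h
  norm_num [Finset.sum_range_succ, Nat.factorial] at h
  linarith

/-- Log-concavity of `𝔧₁` in `t²` bounds its `8/3`-th power on a block by a tangent exponential. -/
lemma besselTail_le_add_of_tangent {s s' m h A B : ℝ} (hs : 0 ≤ s) (hss : s ≤ s') (hA : 0 ≤ A)
    (hm : m - h = s ^ 2 / 4) (hm' : m + h = s' ^ 2 / 4) (hmax : m + h ≤ 1369 / 400)
    (hval : cliff 1 m ^ 8 ≤ A ^ 3) (hslope : 8 / 3 * cliff 2 m ≤ B * cliff 1 m) (hBh : B * h ≤ 1) :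
    besselTail s ≤ 4 * A * (h + B ^ 2 * h ^ 3 / 6 + B ^ 4 * h ^ 5 / 96) + besselTail s' := by
  have hh : 0 ≤ h := by nlinarith
  have hm0 : m ∈ Icc (0 : ℝ) (1369 / 400) := ⟨by nlinarith [sq_nonneg s], by linarith⟩
  have h1 := cliff_pos le_rfl m hm0
  have h2 := cliff_pos (n := 2) (by norm_num) m hm0
  set β : ℝ := 8 / 3 * (cliff 2 m / cliff 1 m)
  have hβ0 : 0 ≤ β := by positivity
  have hβB : β ≤ B := by
    rw [← mul_le_mul_iff_left₀ h1]
    calc β * cliff 1 m = 8 / 3 * cliff 2 m := by simp only [β]; field_simp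
      _ ≤ _ := hslope
  set P : ℝ → ℝ := fun v => 1 - β * v + (β * v) ^ 2 / 2 - (β * v) ^ 3 / 6 + 5 / 96 * (β * v) ^ 4
  set G : ℝ → ℝ := fun v =>
    v - β * v ^ 2 / 2 + β ^ 2 * v ^ 3 / 6 - β ^ 3 * v ^ 4 / 24 + β ^ 4 * v ^ 5 / 96
  have hpt : ∀ t ∈ Icc s s', |cliff 1 (t ^ 2 / 4)| ^ (8 / 3 : ℝ) * t ≤
      A * P (t ^ 2 / 4 - m) * t := fun t ht => by
    have ht0 : 0 ≤ t := hs.trans ht.1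
    have hlo : s ^ 2 / 4 ≤ t ^ 2 / 4 := by have := ht.1; gcongr
    have hhi : t ^ 2 / 4 ≤ s' ^ 2 / 4 := by have := ht.2; gcongr
    have hz : t ^ 2 / 4 ∈ Icc (0 : ℝ) (1369 / 400) := ⟨by positivity, by linarith⟩
    have hv : |t ^ 2 / 4 - m| ≤ h := abs_le.2 ⟨by linarith, by linarith⟩
    have hy : |β * (t ^ 2 / 4 - m)| ≤ 1 := by
      rw [abs_mul, abs_of_nonneg hβ0]
      calc β * |t ^ 2 / 4 - m| ≤ B * h := by gcongr; exact hβ0.trans hβB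
        _ ≤ 1 := hBh
    have hA' : cliff 1 m ^ (8 / 3 : ℝ) ≤ A := by
      calc cliff 1 m ^ (8 / 3 : ℝ) = (cliff 1 m ^ 8) ^ (1 / 3 : ℝ) := by
            rw [← rpow_natCast (cliff 1 m) 8, ← rpow_mul h1.le]; norm_num
        _ ≤ (A ^ 3) ^ (1 / 3 : ℝ) := by gcongr
        _ = A := by rw [← rpow_natCast A 3, ← rpow_mul hA]; norm_num
    have hP := exp_neg_le_quartic hy
    refine mul_le_mul_of_nonneg_right ?_ ht0
    rw [abs_of_pos (cliff_pos le_rfl _ hz)]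
    calc cliff 1 (t ^ 2 / 4) ^ (8 / 3 : ℝ)
        ≤ (cliff 1 m * exp (-(cliff 2 m / cliff 1 m) * (t ^ 2 / 4 - m))) ^ (8 / 3 : ℝ) :=
          rpow_le_rpow (cliff_pos le_rfl _ hz).le (cliff_one_le_exp_tangent hm0 hz) (by norm_num)
      _ = cliff 1 m ^ (8 / 3 : ℝ) * exp (-(β * (t ^ 2 / 4 - m))) := by
          rw [mul_rpow h1.le (exp_pos _).le, ← exp_mul]
          congr 2
          simp only [β]
          ring
      _ ≤ A * P (t ^ 2 / 4 - m) := mul_le_mul hA' hP (exp_pos _).le hA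
  have hderiv : ∀ t, HasDerivAt (fun t : ℝ => 2 * A * G (t ^ 2 / 4 - m))
      (A * P (t ^ 2 / 4 - m) * t) t := fun t => by
    have hv : HasDerivAt (fun t : ℝ => t ^ 2 / 4 - m) (t / 2) t := by
      refine ((((hasDerivAt_id t).pow 2).div_const 4).sub_const m).congr_deriv ?_
      norm_num
      ring
    have hG := ((((hv.sub (((hv.pow 2).const_mul β).div_const 2)).add
      (((hv.pow 3).const_mul (β ^ 2)).div_const 6)).sub
      (((hv.pow 4).const_mul (β ^ 3)).div_const 24)).add
      (((hv.pow 5).const_mul (β ^ 4)).div_const 96)).const_mul (2 * A)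
    refine hG.congr_deriv ?_
    simp only [P]
    norm_num
    ring
  have hcont : Continuous fun t : ℝ => A * P (t ^ 2 / 4 - m) * t := by
    simp only [P]
    fun_prop
  have hInt := intervalIntegral.integral_mono_on (μ := volume) hss
    (continuous_abs_cliff_rpow_mul.intervalIntegrable _ _) (hcont.intervalIntegrable _ _) hpt
  rw [intervalIntegral.integral_eq_sub_of_hasDerivAt (fun t _ => hderiv t)
    (hcont.intervalIntegrable _ _), ← hm, ← hm'] at hInt
  rw [besselTail_eq_add hs hss]
  refine add_le_add_left (hInt.trans ?_) _
  calc 2 * A * G (m + h - m) - 2 * A * G (m - h - m)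
      = 4 * A * (h + β ^ 2 * h ^ 3 / 6 + β ^ 4 * h ^ 5 / 96) := by simp only [G]; ring
    _ ≤ _ := by gcongr

/-! ### Numerical bounds -/

lemma sq_mem_Icc_of_mem {x a e : ℝ} (h : x ∈ Icc (a - e) (a + e)) :
    x ^ 2 ∈ Icc (a ^ 2 - 2 * |a| * e) ((|a| + e) ^ 2) := by
  have h1 : |x - a| ≤ e := abs_le.2 ⟨by linarith [h.1], by linarith [h.2]⟩
  have h2 : |x| ≤ |a| + e := by linarith [abs_sub_abs_le_abs_sub x a]
  have h3 : -(|a| * e) ≤ a * (x - a) := by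
    have := neg_abs_le (a * (x - a))
    rw [abs_mul] at this
    nlinarith [abs_nonneg a]
  constructor
  · nlinarith [sq_nonneg (x - a)]
  · rw [← sq_abs x]
    gcongr

lemma bessel_bounds {z a₀ a₁ a₂ e lo hi K : ℝ} (hz : 0 ≤ z)
    (h0 : cliff 0 z ∈ Icc (a₀ - e) (a₀ + e)) (h1 : cliff 1 z ∈ Icc (a₁ - e) (a₁ + e))
    (h2 : cliff 2 z ∈ Icc (a₂ - e) (a₂ + e))
    (hlo : lo ≤ a₀ ^ 2 - 2 * |a₀| * e + z * (a₁ ^ 2 - 2 * |a₁| * e))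
    (hhi : (|a₀| + e) ^ 2 + z * (|a₁| + e) ^ 2 ≤ hi)
    (hK : (|a₁| + e) ^ 2 + z * (|a₂| + e) ^ 2 ≤ K) :
    besselPhi z ∈ Icc lo hi ∧ besselEnergy z ≤ K := by
  have s0 := sq_mem_Icc_of_mem h0
  have s1 := sq_mem_Icc_of_mem h1
  have s2 := sq_mem_Icc_of_mem h2
  have p1 := mul_le_mul_of_nonneg_left s1.1 hz
  have p1' := mul_le_mul_of_nonneg_left s1.2 hz
  have p2 := mul_le_mul_of_nonneg_left s2.2 hz
  simp only [besselPhi, besselEnergy]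
  exact ⟨⟨by linarith [s0.1], by linarith [s0.2]⟩, by linarith [s1.2]⟩

lemma bessel_bounds_16_5 :
    besselPhi ((16 / 5) ^ 2 / 4) ∈ Icc (17081 / 100000) (4271 / 25000) ∧
      besselEnergy ((16 / 5) ^ 2 / 4) ≤ (4907 / 10000) ^ 3 := by
  refine bessel_bounds (a₀ := -80047 / 250000) (a₁ := 8167 / 50000) (a₂ := 94439 / 500000)
    (e := 1 / 10 ^ 6) (by norm_num) ?_ ?_ ?_ ?_ ?_ ?_
  · apply cliff_mem_Icc 0 9 <;> norm_num [Finset.sum_range_succ, Nat.factorial]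
  · apply cliff_mem_Icc 1 9 <;> norm_num [Finset.sum_range_succ, Nat.factorial]
  · apply cliff_mem_Icc 2 9 <;> norm_num [Finset.sum_range_succ, Nat.factorial]
  all_goals norm_num [abs_of_nonneg, abs_of_neg]

lemma bessel_bounds_37_10 :
    besselPhi ((37 / 10) ^ 2 / 4) ∈ Icc (16227 / 100000) (1623 / 10000) ∧
      besselEnergy ((37 / 10) ^ 2 / 4) ≤ (3793 / 10000) ^ 3 := by
  refine bessel_bounds (a₀ := -39923 / 100000) (a₁ := 29099 / 1000000) (a₂ := 125151 / 1000000)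
    (e := 1 / 10 ^ 6) (by norm_num) ?_ ?_ ?_ ?_ ?_ ?_
  · apply cliff_mem_Icc 0 10 <;> norm_num [Finset.sum_range_succ, Nat.factorial]
  · apply cliff_mem_Icc 1 10 <;> norm_num [Finset.sum_range_succ, Nat.factorial]
  · apply cliff_mem_Icc 2 10 <;> norm_num [Finset.sum_range_succ, Nat.factorial]
  all_goals norm_num [abs_of_nonneg, abs_of_neg]

lemma bessel_bounds_22_5 :
    besselPhi ((22 / 5) ^ 2 / 4) ∈ Icc (989 / 6250) (15827 / 100000) ∧
      besselEnergy ((22 / 5) ^ 2 / 4) ≤ (139 / 500) ^ 3 := by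
  refine bessel_bounds (a₀ := -342257 / 1000000) (a₁ := -92171 / 1000000) (a₂ := 51671 / 1000000)
    (e := 1 / 10 ^ 6) (by norm_num) ?_ ?_ ?_ ?_ ?_ ?_
  · apply cliff_mem_Icc 0 11 <;> norm_num [Finset.sum_range_succ, Nat.factorial]
  · apply cliff_mem_Icc 1 11 <;> norm_num [Finset.sum_range_succ, Nat.factorial]
  · apply cliff_mem_Icc 2 11 <;> norm_num [Finset.sum_range_succ, Nat.factorial]
  all_goals norm_num [abs_of_nonneg, abs_of_neg]

lemma bessel_bounds_24_5 :
    besselPhi ((24 / 5) ^ 2 / 4) ∈ Icc (14689 / 100000) (3673 / 25000) ∧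
      besselEnergy ((24 / 5) ^ 2 / 4) ≤ (1307 / 5000) ^ 3 := by
  refine bessel_bounds (a₀ := -9617 / 40000) (a₁ := -199 / 1600) (a₂ := 5037 / 250000)
    (e := 1 / 10 ^ 6) (by norm_num) ?_ ?_ ?_ ?_ ?_ ?_
  · apply cliff_mem_Icc 0 12 <;> norm_num [Finset.sum_range_succ, Nat.factorial]
  · apply cliff_mem_Icc 1 12 <;> norm_num [Finset.sum_range_succ, Nat.factorial]
  · apply cliff_mem_Icc 2 12 <;> norm_num [Finset.sum_range_succ, Nat.factorial]
  all_goals norm_num [abs_of_nonneg, abs_of_neg]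

lemma bessel_bounds_51_10 :
    besselPhi ((51 / 10) ^ 2 / 4) ∈ Icc (2689 / 20000) (1681 / 12500) ∧
      besselEnergy ((51 / 10) ^ 2 / 4) ≤ (2599 / 10000) ^ 3 := by
  refine bessel_bounds (a₀ := -28867 / 200000) (a₁ := -26439 / 200000) (a₂ := 1867 / 1000000)
    (e := 1 / 10 ^ 6) (by norm_num) ?_ ?_ ?_ ?_ ?_ ?_
  · apply cliff_mem_Icc 0 12 <;> norm_num [Finset.sum_range_succ, Nat.factorial]
  · apply cliff_mem_Icc 1 12 <;> norm_num [Finset.sum_range_succ, Nat.factorial]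
  · apply cliff_mem_Icc 2 12 <;> norm_num [Finset.sum_range_succ, Nat.factorial]
  all_goals norm_num [abs_of_nonneg, abs_of_neg]

lemma bessel_bounds_7_1 :
    besselPhi (7 ^ 2 / 4) ∈ Icc (1801 / 20000) (563 / 6250) ∧
      besselEnergy (7 ^ 2 / 4) ≤ (1953 / 10000) ^ 3 := by
  refine bessel_bounds (a₀ := 300079 / 1000000) (a₁ := -669 / 500000) (a₂ := -4921 / 200000)
    (e := 1 / 10 ^ 6) (by norm_num) ?_ ?_ ?_ ?_ ?_ ?_
  · apply cliff_mem_Icc 0 15 <;> norm_num [Finset.sum_range_succ, Nat.factorial]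
  · apply cliff_mem_Icc 1 15 <;> norm_num [Finset.sum_range_succ, Nat.factorial]
  · apply cliff_mem_Icc 2 15 <;> norm_num [Finset.sum_range_succ, Nat.factorial]
  all_goals norm_num [abs_of_nonneg, abs_of_neg]

lemma bessel_bounds_42_5 :
    besselPhi ((42 / 5) ^ 2 / 4) ∈ Icc (7809 / 100000) (1953 / 25000) ∧
      besselEnergy ((42 / 5) ^ 2 / 4) ≤ (1611 / 10000) ^ 3 := by
  refine bessel_bounds (a₀ := 69157 / 1000000) (a₁ := 64473 / 1000000) (a₂ := -133 / 500000)
    (e := 1 / 10 ^ 6) (by norm_num) ?_ ?_ ?_ ?_ ?_ ?_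
  · apply cliff_mem_Icc 0 17 <;> norm_num [Finset.sum_range_succ, Nat.factorial]
  · apply cliff_mem_Icc 1 17 <;> norm_num [Finset.sum_range_succ, Nat.factorial]
  · apply cliff_mem_Icc 2 17 <;> norm_num [Finset.sum_range_succ, Nat.factorial]
  all_goals norm_num [abs_of_nonneg, abs_of_neg]

lemma bessel_bounds_58_5 :
    besselPhi ((58 / 5) ^ 2 / 4) ∈ Icc (279 / 5000) (5583 / 100000) ∧
      besselEnergy ((58 / 5) ^ 2 / 4) ≤ (293 / 2500) ^ 3 := by
  refine bessel_bounds (a₀ := -5577 / 125000) (a₁ := -1 / 25) (a₂ := 137 / 1000000)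
    (e := 1 / 10 ^ 6) (by norm_num) ?_ ?_ ?_ ?_ ?_ ?_
  · apply cliff_mem_Icc 0 21 <;> norm_num [Finset.sum_range_succ, Nat.factorial]
  · apply cliff_mem_Icc 1 21 <;> norm_num [Finset.sum_range_succ, Nat.factorial]
  · apply cliff_mem_Icc 2 21 <;> norm_num [Finset.sum_range_succ, Nat.factorial]
  all_goals norm_num [abs_of_nonneg, abs_of_neg]

lemma besselTail_le_3_2 : besselTail (3 / 2) ≤ 756 / 3125 + besselTail (19 / 10) := by
  have h1 : cliff 1 (293 / 400) ∈ Icc (67583 / 100000) (675833 / 1000000) := by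
    apply cliff_mem_Icc 1 6 <;> norm_num [Finset.sum_range_succ, Nat.factorial]
  have h2 : cliff 2 (293 / 400) ∈ Icc (97141 / 250000) (388567 / 1000000) := by
    apply cliff_mem_Icc 2 6 <;> norm_num [Finset.sum_range_succ, Nat.factorial]
  have hlo := h1.1
  refine (besselTail_le_add_of_tangent (s' := 19 / 10) (m := 293 / 400) (h := 17 / 100)
    (A := 4397 / 12500) (B := 7667 / 5000) (by norm_num) (by norm_num) (by norm_num) (by norm_num)
    (by norm_num) (by norm_num) ?_ (by linarith [h1.1, h2.2]) (by norm_num)).trans ?_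
  · calc cliff 1 (293 / 400) ^ 8 ≤ (675833 / 1000000) ^ 8 := by
          have := h1.2
          have : (0 : ℝ) ≤ cliff 1 (293 / 400) := le_trans (by norm_num) hlo
          gcongr
      _ ≤ _ := by norm_num
  · gcongr
    norm_num

lemma besselTail_le_19_10 : besselTail (19 / 10) ≤ 16407 / 100000 + besselTail (23 / 10) := by
  have h1 : cliff 1 (89 / 80) ∈ Icc (537837 / 1000000) (6723 / 12500) := by
    apply cliff_mem_Icc 1 7 <;> norm_num [Finset.sum_range_succ, Nat.factorial]
  have h2 : cliff 2 (89 / 80) ∈ Icc (16927 / 50000) (338543 / 1000000) := by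
    apply cliff_mem_Icc 2 7 <;> norm_num [Finset.sum_range_succ, Nat.factorial]
  have hlo := h1.1
  refine (besselTail_le_add_of_tangent (s' := 23 / 10) (m := 89 / 80) (h := 21 / 100)
    (A := 4783 / 25000) (B := 4197 / 2500) (by norm_num) (by norm_num) (by norm_num) (by norm_num)
    (by norm_num) (by norm_num) ?_ (by linarith [h1.1, h2.2]) (by norm_num)).trans ?_
  · calc cliff 1 (89 / 80) ^ 8 ≤ (6723 / 12500) ^ 8 := by
          have := h1.2
          have : (0 : ℝ) ≤ cliff 1 (89 / 80) := le_trans (by norm_num) hlo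
          gcongr
      _ ≤ _ := by norm_num
  · gcongr
    norm_num

lemma besselTail_le_23_10 : besselTail (23 / 10) ≤ 8719 / 100000 + besselTail (27 / 10) := by
  have h1 : cliff 1 (629 / 400) ∈ Icc (15793 / 40000) (98707 / 250000) := by
    apply cliff_mem_Icc 1 8 <;> norm_num [Finset.sum_range_succ, Nat.factorial]
  have h2 : cliff 2 (629 / 400) ∈ Icc (284369 / 1000000) (71093 / 250000) := by
    apply cliff_mem_Icc 2 8 <;> norm_num [Finset.sum_range_succ, Nat.factorial]
  have hlo := h1.1
  refine (besselTail_le_add_of_tangent (s' := 27 / 10) (m := 629 / 400) (h := 1 / 4)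
    (A := 8391 / 100000) (B := 19209 / 10000) (by norm_num) (by norm_num) (by norm_num) (by norm_num)
    (by norm_num) (by norm_num) ?_ (by linarith [h1.1, h2.2]) (by norm_num)).trans ?_
  · calc cliff 1 (629 / 400) ^ 8 ≤ (98707 / 250000) ^ 8 := by
          have := h1.2
          have : (0 : ℝ) ≤ cliff 1 (629 / 400) := le_trans (by norm_num) hlo
          gcongr
      _ ≤ _ := by norm_num
  · gcongr
    norm_num

lemma besselTail_le_27_10 : besselTail (27 / 10) ≤ 743 / 20000 + besselTail (16 / 5) := by
  have h1 : cliff 1 (1753 / 800) ∈ Icc (238889 / 1000000) (59723 / 250000) := by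
    apply cliff_mem_Icc 1 8 <;> norm_num [Finset.sum_range_succ, Nat.factorial]
  have h2 : cliff 2 (1753 / 800) ∈ Icc (27683 / 125000) (221467 / 1000000) := by
    apply cliff_mem_Icc 2 8 <;> norm_num [Finset.sum_range_succ, Nat.factorial]
  have hlo := h1.1
  refine (besselTail_le_add_of_tangent (s' := 16 / 5) (m := 1753 / 800) (h := 59 / 160)
    (A := 1099 / 50000) (B := 6181 / 2500) (by norm_num) (by norm_num) (by norm_num) (by norm_num)
    (by norm_num) (by norm_num) ?_ (by linarith [h1.1, h2.2]) (by norm_num)).trans ?_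
  · calc cliff 1 (1753 / 800) ^ 8 ≤ (59723 / 250000) ^ 8 := by
          have := h1.2
          have : (0 : ℝ) ≤ cliff 1 (1753 / 800) := le_trans (by norm_num) hlo
          gcongr
      _ ≤ _ := by norm_num
  · gcongr
    norm_num

lemma besselTail_three_halves_le : besselTail (3 / 2) ≤ 603 / 1000 := by
  obtain ⟨⟨l0, u0⟩, e0⟩ := bessel_bounds_16_5
  obtain ⟨⟨l1, u1⟩, e1⟩ := bessel_bounds_37_10
  obtain ⟨⟨l2, u2⟩, e2⟩ := bessel_bounds_22_5
  obtain ⟨⟨l3, u3⟩, e3⟩ := bessel_bounds_24_5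
  obtain ⟨⟨l4, u4⟩, e4⟩ := bessel_bounds_51_10
  obtain ⟨⟨l5, u5⟩, e5⟩ := bessel_bounds_7_1
  obtain ⟨⟨l6, u6⟩, e6⟩ := bessel_bounds_42_5
  obtain ⟨⟨l7, u7⟩, e7⟩ := bessel_bounds_58_5
  have t0 := besselTail_le_add (s' := 37 / 10) (by norm_num) (by norm_num) (by norm_num) e0
  have t1 := besselTail_le_add (s' := 22 / 5) (by norm_num) (by norm_num) (by norm_num) e1
  have t2 := besselTail_le_add (s' := 24 / 5) (by norm_num) (by norm_num) (by norm_num) e2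
  have t3 := besselTail_le_add (s' := 51 / 10) (by norm_num) (by norm_num) (by norm_num) e3
  have t4 := besselTail_le_add (s' := 7) (by norm_num) (by norm_num) (by norm_num) e4
  have t5 := besselTail_le_add (s' := 42 / 5) (by norm_num) (by norm_num) (by norm_num) e5
  have t6 := besselTail_le_add (s' := 58 / 5) (by norm_num) (by norm_num) (by norm_num) e6
  have t7 := besselTail_le (by norm_num) (by norm_num) e7
  linarith [besselTail_le_3_2, besselTail_le_19_10, besselTail_le_23_10, besselTail_le_27_10]

/-! ### Comparison with the Gaussian -/

lemma exp_third_le : exp (1 / 3) ≤ 67 / 48 := by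
  refine le_of_pow_le_pow_left₀ three_ne_zero (by norm_num) ?_
  rw [← exp_nat_mul]
  have := exp_one_lt_d9
  norm_num
  linarith

/-- On `[0, 3/2]` the function `|𝔧₁|^{8/3}` exceeds the Gaussian at most by a small polynomial. -/
lemma abs_cliff_rpow_le_near {t : ℝ} (h0 : 0 ≤ t) (h1 : t ≤ 3 / 2) :
    |cliff 1 (t ^ 2 / 4)| ^ (8 / 3 : ℝ) ≤ exp (-(exp (1 / 3) / 4) * t ^ 2) +
      (t ^ 2 / 64 - t ^ 4 / 144) * (1 - t ^ 2 / 3 + t ^ 4 / 18) := by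
  have ht2 : t ^ 2 ≤ 9 / 4 := by nlinarith
  set z : ℝ := t ^ 2 / 4 with hz
  have hz0 : 0 ≤ z := by positivity
  have hz1 : z ≤ 9 / 16 := by linarith
  have hzI : z ∈ Icc (0 : ℝ) (1369 / 400) := ⟨hz0, by linarith⟩
  set x : ℝ := 4 * z / 3 + z ^ 2 / 9
  set D : ℝ := z * (9 / 16 - z) / 9
  have hD : 0 ≤ D := by
    have : 0 ≤ 9 / 16 - z := by linarith
    positivity
  have hxD : exp (1 / 3) * z - x ≤ D := by
    have := mul_le_mul_of_nonneg_right exp_third_le hz0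
    simp only [x, D]
    linarith
  have hpow : |cliff 1 z| ^ (8 / 3 : ℝ) ≤ exp (-x) := by
    rw [abs_of_pos (cliff_pos le_rfl z hzI)]
    refine (rpow_le_rpow (cliff_pos le_rfl z hzI).le (cliff_one_le_exp_quadratic hzI)
      (by norm_num)).trans_eq ?_
    rw [← exp_mul]
    congr 1
    simp only [x]
    ring
  have hdiff : exp (-x) * (1 - D) ≤ exp (-(exp (1 / 3) * z)) := by
    rw [show -(exp (1 / 3) * z) = -x + -(exp (1 / 3) * z - x) by ring, exp_add]
    have := add_one_le_exp (-(exp (1 / 3) * z - x))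
    gcongr
    linarith
  have hquad : exp (-x) ≤ 1 - t ^ 2 / 3 + t ^ 4 / 18 := by
    set s : ℝ := t ^ 2 / 3
    have hs : 0 ≤ s := by positivity
    have hq := quadratic_le_exp_of_nonneg hs
    calc exp (-x) ≤ exp (-s) := by
          gcongr
          simp only [x, s, hz]
          nlinarith [sq_nonneg z]
      _ ≤ 1 - s + s ^ 2 / 2 := by
          rw [exp_neg, inv_le_iff_one_le_mul₀ (exp_pos _)]
          have hpos : 0 ≤ 1 - s + s ^ 2 / 2 := by nlinarith [sq_nonneg (s - 1)]
          nlinarith [mul_le_mul_of_nonneg_left hq hpos, sq_nonneg (s ^ 2)]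
      _ = _ := by simp only [s]; ring
  calc |cliff 1 z| ^ (8 / 3 : ℝ) ≤ exp (-(exp (1 / 3) * z)) + D * exp (-x) := by linarith
    _ ≤ exp (-(exp (1 / 3) * z)) + D * (1 - t ^ 2 / 3 + t ^ 4 / 18) := by gcongr
    _ = _ := by
      simp only [D, hz]
      ring_nf

lemma rpow_one_fifth_le {y : ℝ} (hy : 0 ≤ y) :
    y ^ (1 / 5 : ℝ) ≤ 26 / 25 + 2000 / 28561 * y := by
  calc y ^ (1 / 5 : ℝ) ≤ ((26 / 25 + 2000 / 28561 * y) ^ 5) ^ (1 / 5 : ℝ) := by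
        gcongr
        have := one_add_mul_le_pow (a := (26 / 25 + 2000 / 28561 * y) / (13 / 10) - 1)
          (by linarith) 5
        rw [add_sub_cancel, div_pow] at this
        norm_num at this
        linarith
    _ = _ := by
        rw [← rpow_natCast _ 5, ← rpow_mul (by positivity)]
        norm_num

lemma rpow_sub_one_le {p t : ℝ} (hp : 4 / 5 ≤ p) (h0 : 0 < t) (h1 : t ≤ 37 / 10) :
    t ^ (p - 1) ≤ (37 / 10) ^ (p - 2) *
      (37 / 10 * (26 / 25 + 2000 / 28561 * (37 / 10 / t))) := by
  have hy : 1 ≤ 37 / 10 / t := (one_le_div h0).2 h1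
  have hsplit : t ^ (p - 1) = (37 / 10) ^ (p - 2) * (t * (37 / 10 / t) ^ (2 - p)) := by
    rw [div_rpow (by norm_num) h0.le, show (2 : ℝ) - p = -(p - 2) by ring,
      rpow_neg (by norm_num), rpow_neg h0.le, show p - 1 = p - 2 + 1 by ring,
      rpow_add h0, rpow_one]
    have : (37 / 10 : ℝ) ^ (p - 2) ≠ 0 := by positivity
    have : t ^ (p - 2) ≠ 0 := by positivity
    field_simp
  rw [hsplit]
  refine mul_le_mul_of_nonneg_left ?_ (by positivity)
  calc t * (37 / 10 / t) ^ (2 - p) ≤ t * (37 / 10 / t) ^ (1 + 1 / 5 : ℝ) := by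
        gcongr
        linarith
    _ = 37 / 10 * (37 / 10 / t) ^ (1 / 5 : ℝ) := by
        rw [rpow_add (by positivity), rpow_one]
        field_simp
    _ ≤ _ := by
        gcongr
        exact rpow_one_fifth_le (by positivity)

lemma abs_cliff_rpow_le_middle {t : ℝ} (h0 : 3 / 2 ≤ t) (h1 : t ≤ 37 / 10) :
    |cliff 1 (t ^ 2 / 4)| ^ (8 / 3 : ℝ) ≤ exp (-(67 / 192) * t ^ 2) := by
  have hlo : 9 / 16 ≤ t ^ 2 / 4 := by nlinarith
  have hhi : t ^ 2 / 4 ≤ 1369 / 400 := by nlinarith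
  have hc : cliff 1 (9 / 16) ∈ Icc (743 / 1000) (744 / 1000) := by
    apply cliff_mem_Icc 1 6 <;> norm_num [Finset.sum_range_succ, Nat.factorial]
  have hexp : 744 / 1000 ≤ exp (-(67 / 128) * (9 / 16)) := by
    have := (abs_le.1 (exp_bound (x := -(67 / 128) * (9 / 16)) (by norm_num [abs_of_neg])
      (n := 5) (by norm_num))).1
    norm_num [Finset.sum_range_succ, Nat.factorial, abs_of_neg] at this ⊢
    linarith
  have hpos := cliff_pos le_rfl (t ^ 2 / 4) ⟨by linarith, hhi⟩
  rw [abs_of_pos hpos]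
  refine (rpow_le_rpow hpos.le (cliff_one_le_exp_of_le (by norm_num) hlo hhi (hc.2.trans hexp))
    (by norm_num)).trans_eq ?_
  rw [← exp_mul]
  ring_nf

/-- `(t² / 64 - t⁴ / 144) (1 - t² / 3 + t⁴ / 18)` times a majorant of `t ^ (p - 1)`. -/
noncomputable def nearWeight (t : ℝ) : ℝ :=
  (t / 64 - t ^ 3 / 144) * (1 - t ^ 2 / 3 + t ^ 4 / 18) *
    (37 / 10 * (26 / 25 * t + 2000 / 28561 * (37 / 10)))

lemma continuous_nearWeight : Continuous nearWeight := by
  unfold nearWeight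
  fun_prop

lemma integral_nearWeight_le : ∫ t in (0 : ℝ)..3 / 2, nearWeight t ≤ 27 / 1000 := by
  have hd : ∀ t : ℝ, HasDerivAt (fun t : ℝ => 37 / 10 * (26 / 25 *
      (1 / 64 * t ^ 3 / 3 - 7 / 576 * t ^ 5 / 5 + 11 / 3456 * t ^ 7 / 7 - 1 / 2592 * t ^ 9 / 9) +
      2000 / 28561 * (37 / 10) *
      (1 / 64 * t ^ 2 / 2 - 7 / 576 * t ^ 4 / 4 + 11 / 3456 * t ^ 6 / 6 - 1 / 2592 * t ^ 8 / 8)))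
      (nearWeight t) t := fun t => by
    have hp := fun (n : ℕ) (c m : ℝ) =>
      ((((hasDerivAt_id t).pow n).const_mul c).div_const m)
    have := ((((((hp 3 (1 / 64) 3).sub (hp 5 (7 / 576) 5)).add (hp 7 (11 / 3456) 7)).sub
      (hp 9 (1 / 2592) 9)).const_mul (26 / 25)).add
      (((((hp 2 (1 / 64) 2).sub (hp 4 (7 / 576) 4)).add (hp 6 (11 / 3456) 6)).sub
      (hp 8 (1 / 2592) 8)).const_mul (2000 / 28561 * (37 / 10)))).const_mul (37 / 10)
    refine this.congr_deriv ?_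
    simp only [nearWeight, id]
    norm_num
    ring
  rw [intervalIntegral.integral_eq_sub_of_hasDerivAt (fun t _ => hd t)
    (continuous_nearWeight.intervalIntegrable _ _)]
  norm_num

lemma le_integral_middle :
    638 / 1000 ≤ ∫ t in (3 / 2 : ℝ)..37 / 10, exp (-(67 / 192) * t ^ 2) * t := by
  have hd : ∀ t : ℝ, HasDerivAt (fun t : ℝ => -(96 / 67) * exp (-(67 / 192) * t ^ 2))
      (exp (-(67 / 192) * t ^ 2) * t) t := fun t => by
    refine (((((hasDerivAt_id t).pow 2).const_mul (-(67 / 192))).exp).const_mul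
      (-(96 / 67))).congr_deriv ?_
    norm_num
    ring
  rw [intervalIntegral.integral_eq_sub_of_hasDerivAt (fun t _ => hd t)
    ((by fun_prop : Continuous fun t : ℝ => exp (-(67 / 192) * t ^ 2) * t).intervalIntegrable _ _)]
  have h1 : 455 / 1000 ≤ exp (-(67 / 192) * (3 / 2) ^ 2) := by
    have := (abs_le.1 (exp_bound (x := -(67 / 192) * (3 / 2) ^ 2) (by norm_num [abs_of_neg])
      (n := 6) (by norm_num))).1
    norm_num [Finset.sum_range_succ, Nat.factorial, abs_of_neg] at this ⊢
    linarith
  have h2 : exp (-(67 / 192) * (37 / 10) ^ 2) ≤ 9 / 1000 := by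
    rw [neg_mul, exp_neg, inv_le_comm₀ (exp_pos _) (by norm_num)]
    refine le_trans ?_ (sum_le_exp_of_nonneg (by norm_num) 14)
    norm_num [Finset.sum_range_succ, Nat.factorial]
  linarith

/-- Up to the factor `(37/10) ^ (p - 2)`, a majorant of the difference between
`|𝔧₁(t)|^{8/3} t^{p-1}` and its Gaussian counterpart, uniformly in `p ∈ [4/5, 2]`. -/
noncomputable def excess : ℝ → ℝ :=
  (Ioc 0 (3 / 2)).indicator nearWeight +
    (Ioi (3 / 2)).indicator (fun t => |cliff 1 (t ^ 2 / 4)| ^ (8 / 3 : ℝ) * t) -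
    (Ioc (3 / 2) (37 / 10)).indicator (fun t => exp (-(67 / 192) * t ^ 2) * t)

lemma rpow_sub_one_eq {p t : ℝ} (ht : 0 < t) : t ^ (p - 1) = t ^ (p - 2) * t := by
  rw [← rpow_add_one ht.ne']
  ring_nf

lemma abs_cliff_rpow_mul_rpow_le {p t : ℝ} (hp1 : 4 / 5 ≤ p) (hp2 : p ≤ 2) (ht : 0 < t) :
    |cliff 1 (t ^ 2 / 4)| ^ (8 / 3 : ℝ) * t ^ (p - 1) ≤
      t ^ (p - 1) * exp (-(exp (1 / 3) / 4) * t ^ 2) + (37 / 10) ^ (p - 2) * excess t := by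
  set j : ℝ := |cliff 1 (t ^ 2 / 4)| ^ (8 / 3 : ℝ)
  have hj : 0 ≤ j := by positivity
  have htp : 0 < t ^ (p - 1) := by positivity
  rcases le_or_gt t (3 / 2) with h1 | h1
  · have he : excess t = nearWeight t := by
      simp [excess, ht, h1, not_lt.2 h1]
    have hQ : 0 ≤ (t ^ 2 / 64 - t ^ 4 / 144) * (1 - t ^ 2 / 3 + t ^ 4 / 18) := by
      have ht2 : t ^ 2 ≤ 9 / 4 := by nlinarith
      exact mul_nonneg (by nlinarith [sq_nonneg t]) (by nlinarith [sq_nonneg (t ^ 2)])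
    have hnear := mul_le_mul_of_nonneg_right (abs_cliff_rpow_le_near ht.le h1) htp.le
    have hpow := mul_le_mul_of_nonneg_left
      (rpow_sub_one_le hp1 ht (h1.trans (by norm_num))) hQ
    have hw : (t ^ 2 / 64 - t ^ 4 / 144) * (1 - t ^ 2 / 3 + t ^ 4 / 18) * ((37 / 10) ^ (p - 2) *
        (37 / 10 * (26 / 25 + 2000 / 28561 * (37 / 10 / t)))) =
        (37 / 10) ^ (p - 2) * nearWeight t := by
      simp only [nearWeight]
      field_simp
    rw [he]
    linarith
  rcases le_or_gt t (37 / 10) with h2 | h2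
  · have he : excess t = j * t - exp (-(67 / 192) * t ^ 2) * t := by
      simp [excess, h1, h2, not_le.2 h1, j]
    have hmid := abs_cliff_rpow_le_middle h1.le h2
    have hle : (37 / 10 : ℝ) ^ (p - 2) ≤ t ^ (p - 2) :=
      rpow_le_rpow_of_nonpos ht h2 (by linarith)
    have hexp : exp (-(67 / 192) * t ^ 2) ≤ exp (-(exp (1 / 3) / 4) * t ^ 2) :=
      exp_le_exp.2 (mul_le_mul_of_nonneg_right (by linarith [exp_third_le]) (sq_nonneg t))
    have h3 := mul_le_mul_of_nonneg_left hexp htp.le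
    have h4 : 0 ≤ (exp (-(67 / 192) * t ^ 2) - j) * ((t ^ (p - 2) - (37 / 10) ^ (p - 2)) * t) :=
      mul_nonneg (by linarith) (mul_nonneg (by linarith) ht.le)
    rw [he]
    rw [rpow_sub_one_eq ht] at h3 ⊢
    linarith
  · have he : excess t = j * t := by
      simp [excess, h1, not_le.2 h1, not_le.2 h2, j]
    have hle : t ^ (p - 2) ≤ (37 / 10 : ℝ) ^ (p - 2) :=
      rpow_le_rpow_of_nonpos (by norm_num) h2.le (by linarith)
    have h3 := mul_le_mul_of_nonneg_right hle (mul_nonneg hj ht.le)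
    have h4 : 0 ≤ t ^ (p - 1) * exp (-(exp (1 / 3) / 4) * t ^ 2) := by positivity
    rw [he]
    rw [rpow_sub_one_eq ht] at h4 ⊢
    linarith

lemma integrableOn_excess_and_integral_neg :
    IntegrableOn excess (Ioi 0) ∧ ∫ t in Ioi 0, excess t < 0 := by
  have hexp : Continuous fun t : ℝ => exp (-(67 / 192) * t ^ 2) * t := by fun_prop
  have i1 : Integrable ((Ioc 0 (3 / 2)).indicator nearWeight) :=
    (continuous_nearWeight.integrableOn_Ioc).integrable_indicator measurableSet_Ioc
  have i2 : Integrable ((Ioi (3 / 2)).indicator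
      fun t : ℝ => |cliff 1 (t ^ 2 / 4)| ^ (8 / 3 : ℝ) * t) :=
    (integrableOn_abs_cliff_rpow (by norm_num)).integrable_indicator measurableSet_Ioi
  have i3 : Integrable ((Ioc (3 / 2) (37 / 10)).indicator
      fun t : ℝ => exp (-(67 / 192) * t ^ 2) * t) :=
    hexp.integrableOn_Ioc.integrable_indicator measurableSet_Ioc
  refine ⟨((i1.add i2).sub i3).integrableOn, ?_⟩
  have h1 := integral_nearWeight_le
  have h2 := besselTail_three_halves_le
  have h3 := le_integral_middle
  rw [intervalIntegral.integral_of_le (by norm_num)] at h1 h3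
  rw [besselTail] at h2
  rw [excess, integral_sub' (i1.add i2).integrableOn i3.integrableOn,
    integral_add' i1.integrableOn i2.integrableOn,
    setIntegral_indicator measurableSet_Ioc, setIntegral_indicator measurableSet_Ioi,
    setIntegral_indicator measurableSet_Ioc,
    inter_eq_right.2 (Ioc_subset_Ioi_self : Ioc (0 : ℝ) (3 / 2) ⊆ Ioi 0),
    inter_eq_right.2 (Ioi_subset_Ioi (by norm_num : (0 : ℝ) ≤ 3 / 2)),
    inter_eq_right.2 ((Ioc_subset_Ioi_self).trans (Ioi_subset_Ioi (by norm_num : (0 : ℝ) ≤ 3 / 2)))]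
  linarith

lemma integral_gaussian_eq {p : ℝ} (hp : 0 < p) :
    ∫ t in Ioi (0 : ℝ), t ^ (p - 1) * exp (-(exp (1 / 3) / 4) * t ^ 2) =
      exp (-p / 6) * Gfun p 2 := by
  have h := integral_rpow_mul_exp_neg_mul_rpow (p := 2) (q := p - 1) (b := exp (1 / 3) / 4)
    two_pos (by linarith) (by positivity)
  simp only [rpow_two, sub_add_cancel] at h
  rw [h, Gfun, div_rpow (exp_pos _).le (by norm_num), ← exp_mul,
    show (4 : ℝ) = 2 ^ (2 : ℝ) by norm_num, ← rpow_mul two_pos.le]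
  have h2 : (2 : ℝ) ^ (-p / 2) * 2 ^ (3 * p / 2 - 1) = (2 ^ (2 * (-p / 2)))⁻¹ * (1 / 2) := by
    rw [← rpow_neg two_pos.le, ← rpow_add two_pos, one_div, ← rpow_neg_one 2, ← rpow_add two_pos]
    ring_nf
  rw [h2, div_eq_mul_inv]
  ring_nf

/-- For `4/5 ≤ p ≤ 2`: `F(p, 8/3) < e^{-p/6} G(p, 2)`, where
`F(p,s) = ∫_0^∞ |𝔧₁(t)|^s t^{p-1} dt`. -/
theorem F_interp_bound_large_p (p : ℝ) (hp1 : 4 / 5 ≤ p) (hp2 : p ≤ 2) :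
    ∫⁻ t in Set.Ioi (0 : ℝ), ENNReal.ofReal (|jj1 t| ^ (8 / 3 : ℝ) * t ^ (p - 1))
      < ENNReal.ofReal (Real.exp (-p / 6) * Gfun p 2) := by
  have hp0 : 0 < p := by linarith
  obtain ⟨hi, hneg⟩ := integrableOn_excess_and_integral_neg
  have hg : IntegrableOn (fun t : ℝ => t ^ (p - 1) * exp (-(exp (1 / 3) / 4) * t ^ 2)) (Ioi 0) :=
    integrableOn_rpow_mul_exp_neg_mul_sq (by positivity) (by linarith)
  have hInt : IntegrableOn (fun t : ℝ => t ^ (p - 1) * exp (-(exp (1 / 3) / 4) * t ^ 2) +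
      (37 / 10) ^ (p - 2) * excess t) (Ioi 0) := hg.add (hi.const_mul _)
  have hle : ∀ᵐ t ∂volume.restrict (Ioi (0 : ℝ)), |jj1 t| ^ (8 / 3 : ℝ) * t ^ (p - 1) ≤
      t ^ (p - 1) * exp (-(exp (1 / 3) / 4) * t ^ 2) + (37 / 10) ^ (p - 2) * excess t :=
    (ae_restrict_iff' measurableSet_Ioi).2 (ae_of_all _ fun t ht => by
      rw [jj1_eq_cliff]
      exact abs_cliff_rpow_mul_rpow_le hp1 hp2 ht)
  have hnn : ∀ᵐ t ∂volume.restrict (Ioi (0 : ℝ)), 0 ≤ |jj1 t| ^ (8 / 3 : ℝ) * t ^ (p - 1) :=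
    (ae_restrict_iff' measurableSet_Ioi).2 (ae_of_all _ fun t ht => by
      have : 0 < t := ht
      positivity)
  refine (lintegral_mono_ae (hle.mono fun t ht => ENNReal.ofReal_le_ofReal ht)).trans_lt ?_
  rw [← ofReal_integral_eq_lintegral_ofReal hInt ((hnn.and hle).mono fun t ht => ht.1.trans ht.2),
    ← integral_gaussian_eq hp0, integral_add hg (hi.const_mul _), integral_const_mul]
  have hpos : 0 < exp (-p / 6) * Gfun p 2 := by
    have := Gamma_pos_of_pos (half_pos hp0)
    unfold Gfun
    positivity
  rw [← integral_gaussian_eq hp0] at hpos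
  refine (ENNReal.ofReal_lt_ofReal_iff hpos).2 ?_
  have : (37 / 10 : ℝ) ^ (p - 2) * ∫ t in Ioi 0, excess t < 0 :=
    mul_neg_of_pos_of_neg (by positivity) hneg
  linarith
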